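/- Let M be a saturated free algebra on uncountable basis I, with theory T. Then in T^eq, acl^eq(∅) = dcl^eq(∅). -/

import Mathlib

open FirstOrder Language Cardinal Set

universe u v w

namespace Paper

variable {L : FirstOrder.Language.{u, v}}

/-- `a` and `b` (as `n`-tuples) satisfy the same formulas with parameters from `A`. -/
def SameType {M : Type w} [L.Structure M] (A : Set M) {n : ℕ} (a b : Fin n → M) : Prop :=
  ∀ φ : L.Formula (↥A ⊕ Fin n),
    φ.Realize (Sum.elim (fun x => (x : M)) a) ↔ φ.Realize (Sum.elim (fun x => (x : M)) b)

/-- `a` and `b` satisfy the same formulas over the empty set. -/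
def SameType₀ {M : Type w} [L.Structure M] {n : ℕ} (a b : Fin n → M) : Prop :=
  ∀ φ : L.Formula (Fin n), φ.Realize a ↔ φ.Realize b

/-- `M` is `κ`-saturated: every finitely satisfiable (in `M`) collection of formulas in one
variable over a parameter set of size `< κ` is realized in `M`. -/
def IsSat (M : Type w) [L.Structure M] (κ : Cardinal.{w}) : Prop :=
  ∀ A : Set M, #A < κ →
    ∀ p : Set (L.Formula (↥A ⊕ Fin 1)),
      (∀ S : Finset (L.Formula (↥A ⊕ Fin 1)), ↑S ⊆ p →
        ∃ a : Fin 1 → M, ∀ φ ∈ S, φ.Realize (Sum.elim (fun x => (x : M)) a)) →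
      ∃ a : Fin 1 → M, ∀ φ ∈ p, φ.Realize (Sum.elim (fun x => (x : M)) a)

/-- `b` is algebraic over `A` in `M`. -/
def InAcl {M : Type w} [L.Structure M] (A : Set M) (b : M) : Prop :=
  ∃ φ : L.Formula (↥A ⊕ Fin 1),
    φ.Realize (Sum.elim (fun x => (x : M)) (fun _ => b)) ∧
    {x : M | φ.Realize (Sum.elim (fun x => (x : M)) (fun _ => x))}.Finite

/-- A set `I` of `k`-tuples is an indiscernible set: any two injective enumerations
of `n` elements of `I` satisfy the same formulas over `∅`. -/
def IsIndiscSet {M : Type w} [L.Structure M] {k : ℕ} (I : Set (Fin k → M)) : Prop :=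
  ∀ (n : ℕ) (a b : Fin n → (Fin k → M)), Function.Injective a → Function.Injective b →
    (∀ i, a i ∈ I) → (∀ i, b i ∈ I) →
    ∀ φ : L.Formula (Fin n × Fin k),
      (φ.Realize fun p => a p.1 p.2) ↔ (φ.Realize fun p => b p.1 p.2)

/-- The set of all coordinates of the tuples in `I`. -/
def coords {M : Type w} {k : ℕ} (I : Set (Fin k → M)) : Set M :=
  ⋃ e ∈ I, Set.range e

/-- A theory is almost indiscernible if it has a saturated model of cardinality `ℵ₁` which is
contained in the algebraic closure of an indiscernible set of finite tuples of cardinality `ℵ₁`. -/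
def AlmostIndiscernible (T : L.Theory) : Prop :=
  ∃ (M : Type (max u v)) (_ : L.Structure M), M ⊨ T ∧ #M = ℵ₁ ∧ IsSat (L := L) M ℵ₁ ∧
    ∃ (k : ℕ) (I : Set (Fin k → M)), IsIndiscSet (L := L) I ∧ #I = ℵ₁ ∧ ∀ b : M, InAcl (L := L) (coords I) b

/-- A complete type over `A` in one variable, identified with a maximal finitely satisfiable
set of formulas over `A`. -/
def IsCompleteTypeOver (M : Type w) [L.Structure M] (A : Set M)
    (p : Set (L.Formula (↥A ⊕ Fin 1))) : Prop :=
  (∀ S : Finset (L.Formula (↥A ⊕ Fin 1)), ↑S ⊆ p →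
    ∃ a : Fin 1 → M, ∀ φ ∈ S, φ.Realize (Sum.elim (fun x => (x : M)) a)) ∧
  (∀ φ : L.Formula (↥A ⊕ Fin 1), φ ∈ p ∨ φ.not ∈ p)

/-- `T` is `ω`-stable: over every countable parameter set in a model of `T` there are only
countably many complete types. -/
def IsOmegaStable (T : L.Theory) : Prop :=
  ∀ (M : Type (max u v)) (_ : L.Structure M), M ⊨ T →
    ∀ A : Set M, A.Countable → {p | IsCompleteTypeOver (L := L) M A p}.Countable

section Rank

variable {M : Type w} [L.Structure M]

/-- Realization of a formula with parameters from all of `M`. -/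
def RealP {n : ℕ} (φ : L.Formula (M ⊕ Fin n)) (a : Fin n → M) : Prop :=
  φ.Realize (Sum.elim id a)

/-- Morley rank (computed in `M`) of a definable set is at least `α`. -/
def MRGe {n : ℕ} (φ : L.Formula (M ⊕ Fin n)) (α : Ordinal.{0}) : Prop :=
  (∃ a, RealP φ a) ∧ ∀ β < α, ∃ ψ : ℕ → L.Formula (M ⊕ Fin n),
    (∀ i a, RealP (ψ i) a → RealP φ a) ∧
    (∀ i j, i ≠ j → ∀ a, ¬(RealP (ψ i) a ∧ RealP (ψ j) a)) ∧
    ∀ i, MRGe (ψ i) β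
termination_by α
decreasing_by exact ‹_ < α›

/-- Morley rank (computed in `M`) is exactly `α`. -/
def MREq {n : ℕ} (φ : L.Formula (M ⊕ Fin n)) (α : Ordinal.{0}) : Prop :=
  MRGe φ α ∧ ¬ MRGe φ (α + 1)

/-- Every formula over `A` satisfied by `a` has Morley rank at least `α`. -/
def TpRkGe (A : Set M) {n : ℕ} (a : Fin n → M) (α : Ordinal.{0}) : Prop :=
  ∀ φ : L.Formula (↥A ⊕ Fin n),
    φ.Realize (Sum.elim (fun x => (x : M)) a) →
    MRGe (L := L) (φ.relabel (Sum.map (fun x : ↥A => (x : M)) id)) α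

/-- `a` is (forking-)independent from `B` over `A`: the Morley rank of its type does not
drop when the parameters are extended from `A` to `A ∪ B`. -/
def Indep (A : Set M) {n : ℕ} (a : Fin n → M) (B : Set M) : Prop :=
  ∀ α : Ordinal.{0}, TpRkGe (L := L) (A ∪ B) a α ↔ TpRkGe (L := L) A a α

/-- An independent family of realizations: each member is independent from all the others. -/
def IndepFamily (A : Set M) {n : ℕ} {ι : Type*} (J : ι → (Fin n → M)) : Prop :=
  ∀ i : ι, Indep (L := L) A (J i) (⋃ j ∈ {j | j ≠ i}, Set.range (J j))

/-- `tp(a/A)` is stationary (w.r.t. parameter sets of size `< κ`). -/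
def Stationary (κ : Cardinal.{w}) (A : Set M) {n : ℕ} (a : Fin n → M) : Prop :=
  ∀ B : Set M, A ⊆ B → #B < κ → ∀ a' a'' : Fin n → M,
    SameType (L := L) A a' a → SameType (L := L) A a'' a → Indep (L := L) A a' B → Indep (L := L) A a'' B → SameType (L := L) B a' a''

/-- `tp(a/A)` and `tp(b/B)` are nonorthogonal (w.r.t. parameter sets of size `< κ`). -/
def Nonorthogonal (κ : Cardinal.{w}) (A : Set M) {n : ℕ} (a : Fin n → M)
    (B : Set M) {m : ℕ} (b : Fin m → M) : Prop :=
  ∃ C : Set M, A ∪ B ⊆ C ∧ #C < κ ∧ ∃ (a' : Fin n → M) (b' : Fin m → M),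
    SameType (L := L) A a' a ∧ Indep (L := L) A a' C ∧ SameType (L := L) B b' b ∧
    Indep (L := L) B b' C ∧ ¬ Indep (L := L) C a' (Set.range b')

/-- `tp(a/A)` is regular: stationary, nonalgebraic, and orthogonal to all of its forking
extensions. -/
def Regular (κ : Cardinal.{w}) (A : Set M) {n : ℕ} (a : Fin n → M) : Prop :=
  Stationary (L := L) κ A a ∧ (∃ i, ¬ InAcl (L := L) A (a i)) ∧
  ∀ B : Set M, A ⊆ B → #B < κ → ∀ a' : Fin n → M,
    SameType (L := L) A a' a → ¬ Indep (L := L) A a' B → ¬ Nonorthogonal (L := L) κ A a B a'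

/-- U-rank of `tp(a/A)` is at least `α`. -/
def URkGe (κ : Cardinal.{w}) (A : Set M) {n : ℕ} (a : Fin n → M) (α : Ordinal.{0}) : Prop :=
  ∀ β < α, ∃ (B : Set M) (a' : Fin n → M), A ⊆ B ∧ #B < κ ∧
    SameType (L := L) A a' a ∧ ¬ Indep (L := L) A a' B ∧ URkGe κ B a' β
termination_by α
decreasing_by exact ‹_ < α›

end Rank

section Algebra

/-- The theory `T` is equational: every axiom is a universally quantified equation
between terms. -/
def IsEquational (T : L.Theory) : Prop :=
  ∀ φ ∈ T, ∃ (n : ℕ) (t₁ t₂ : L.Term (Empty ⊕ Fin n)),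
    φ = BoundedFormula.alls (t₁.bdEqual t₂)

/-- `A` is free on `X ⊆ A` over the class of models of `T`: `A ⊨ T` and every map from `X`
into a model of `T` extends uniquely to a homomorphism. -/
def IsFreeOn (T : L.Theory) (A : Type w) [L.Structure A] (X : Set A) : Prop :=
  A ⊨ T ∧ ∀ (B : Type w) (_ : L.Structure B), B ⊨ T →
    ∀ f : X → B, ∃! h : A →[L] B, ∀ x : X, h x = f x

/-- An element of a free algebra is basic if it belongs to some basis. -/
def IsBasic (T : L.Theory) {M : Type w} [L.Structure M] (a : M) : Prop :=
  ∃ X : Set M, a ∈ X ∧ IsFreeOn T M X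

/-- A subset of a free algebra is basic if it is contained in some basis. -/
def IsBasicSet (T : L.Theory) {M : Type w} [L.Structure M] (A : Set M) : Prop :=
  ∃ X : Set M, A ⊆ X ∧ IsFreeOn T M X

end Algebra

/-- Tarski–Vaught style: `S` is the underlying set of an elementary substructure. -/
def IsElemSubset {M : Type w} [L.Structure M] (S : Set M) : Prop :=
  S.Nonempty ∧ ∀ (n : ℕ) (φ : L.Formula (Fin (n + 1))) (a : Fin n → M),
    (∀ i, a i ∈ S) → (∃ x : M, φ.Realize (Fin.snoc a x)) →
    ∃ x ∈ S, φ.Realize (Fin.snoc a x)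

/-- Every type over a parameter subset of `S` of size `< κ` that is finitely satisfiable in `M`
is realized inside `S`. -/
def SatInside {M : Type w} [L.Structure M] (S : Set M) (κ : Cardinal.{w}) : Prop :=
  ∀ A : Set M, A ⊆ S → #A < κ →
    ∀ p : Set (L.Formula (↥A ⊕ Fin 1)),
      (∀ Sf : Finset (L.Formula (↥A ⊕ Fin 1)), ↑Sf ⊆ p →
        ∃ a : Fin 1 → M, ∀ φ ∈ Sf, φ.Realize (Sum.elim (fun x => (x : M)) a)) →
      ∃ a : Fin 1 → M, a 0 ∈ S ∧ ∀ φ ∈ p, φ.Realize (Sum.elim (fun x => (x : M)) a)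

end Paper

namespace Paper

section Helpers

open Substructure

variable {L : FirstOrder.Language.{u, v}} {M : Type w} [L.Structure M]

theorem substructure_models (T : L.Theory) (hT : IsEquational T) (hM : M ⊨ T)
    (S : L.Substructure M) : S ⊨ T := by
  refine ⟨fun φ hφ => ?_⟩
  have h := hM.realize_of_mem φ hφ
  obtain ⟨n, t₁, t₂, rfl⟩ := hT φ hφ
  have h' := BoundedFormula.realize_alls.1 h
  refine BoundedFormula.realize_alls.2 fun xs => ?_
  have h2 := h' (fun i => (xs i : M))
  rw [BoundedFormula.realize_bdEqual] at h2 ⊢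
  apply Subtype.val_injective
  have key : ∀ t : L.Term (Empty ⊕ Fin n),
      ((t.realize (Sum.elim (default : Empty → S) xs) : S) : M)
        = t.realize (Sum.elim (default : Empty → M) (fun i => (xs i : M))) := by
    intro t
    have := HomClass.realize_term S.subtype (t := t) (v := Sum.elim (default : Empty → S) xs)
    rw [Substructure.coe_subtype] at this
    rw [← this]
    congr 1
    funext z
    rcases z with z | z
    · exact z.elim
    · rfl
  exact (key t₁).trans (h2.trans (key t₂).symm)

theorem hom_unique {T : L.Theory} {I : Set M} (hfree : IsFreeOn T M I)
    (h₁ h₂ : M →[L] M) (h : ∀ x : I, h₁ x = h₂ x) : h₁ = h₂ :=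
  (hfree.2 M _ hfree.1 (fun x => h₂ x)).unique h (fun _ => rfl)

theorem closure_top {T : L.Theory} (hT : IsEquational T) {I : Set M} (hfree : IsFreeOn T M I)
    (x : M) : x ∈ closure L I := by
  obtain ⟨h, hh, -⟩ := hfree.2 (closure L I) _ (substructure_models T hT hfree.1 _)
    (fun x => ⟨x, subset_closure x.2⟩)
  have : (closure L I).subtype.toHom.comp h = Hom.id L M := by
    apply hom_unique hfree
    intro y
    simp [hh y]
  have h2 := congrArg (fun g : M →[L] M => g x) this
  simp only [Hom.comp_apply, Hom.id_apply] at h2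
  rw [← h2]
  exact (h x).2

theorem exists_supp {T : L.Theory} (hT : IsEquational T) {I : Set M} (hfree : IsFreeOn T M I)
    (x : M) : ∃ F : Finset I, x ∈ closure L (Subtype.val '' (F : Set I)) := by
  classical
  obtain ⟨t, ht⟩ := mem_closure_iff_exists_term.1 (closure_top hT hfree x)
  refine ⟨t.varFinset, mem_closure_iff_exists_term.2
    ⟨t.restrictVar (fun v => ⟨v.1.1, v.1, v.2, rfl⟩), ?_⟩⟩
  rw [← ht]
  exact Term.realize_restrictVar _ (fun _ => rfl)

theorem exists_supp_finite {T : L.Theory} (hT : IsEquational T) {I : Set M}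
    (hfree : IsFreeOn T M I) {β : Type*} [Finite β] (x : β → M) :
    ∃ F : Finset I, ∀ b, x b ∈ closure L (Subtype.val '' (F : Set I)) := by
  classical
  have := Fintype.ofFinite β
  choose F hF using fun b => exists_supp hT hfree (x b)
  refine ⟨Finset.univ.biUnion F, fun b => closure_mono (image_mono ?_) (hF b)⟩
  intro z hz
  simp only [Finset.coe_biUnion, Finset.coe_univ, mem_univ, iUnion_true, mem_iUnion]
  exact ⟨b, hz⟩

theorem exists_aut_of_homs {T : L.Theory} {I : Set M} (hfree : IsFreeOn T M I)
    (f g : M →[L] M) (hgf : ∀ x : I, g (f x) = x) (hfg : ∀ x : I, f (g x) = x) :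
    ∃ σ : M ≃[L] M, ∀ x : M, σ x = f x := by
  have h1 : g.comp f = Hom.id L M := hom_unique hfree _ _ (fun x => by simp [hgf x])
  have h2 : f.comp g = Hom.id L M := hom_unique hfree _ _ (fun x => by simp [hfg x])
  have h1' : ∀ x, g (f x) = x := fun x => congrArg (fun k : M →[L] M => k x) h1
  have h2' : ∀ x, f (g x) = x := fun x => congrArg (fun k : M →[L] M => k x) h2
  refine ⟨⟨⟨f, g, h1', h2'⟩, fun F x => f.map_fun F x, fun r x => ⟨fun h => ?_, f.map_rel r x⟩⟩,
    fun x => rfl⟩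
  have := g.map_rel r _ h
  have e : (g ∘ (f ∘ x)) = x := funext fun i => h1' _
  rw [← e]
  exact this

theorem exists_aut_perm {T : L.Theory} {I : Set M} (hfree : IsFreeOn T M I)
    (π : Equiv.Perm I) : ∃ σ : M ≃[L] M, ∀ x : I, σ x = π x := by
  obtain ⟨f, hf, -⟩ := hfree.2 M _ hfree.1 (fun x => (π x : M))
  obtain ⟨g, hg, -⟩ := hfree.2 M _ hfree.1 (fun x => (π.symm x : M))
  obtain ⟨σ, hσ⟩ := exists_aut_of_homs hfree f g (fun x => by rw [hf, hg]; simp)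
    (fun x => by rw [hg, hf]; simp)
  exact ⟨σ, fun x => by rw [hσ, hf]⟩

theorem aut_eq_on (σ τ : M ≃[L] M) (F : Set M) (h : ∀ x ∈ F, σ x = τ x) (x : M)
    (hx : x ∈ closure L F) : σ x = τ x := by
  have : Set.EqOn σ.toHom τ.toHom F := h
  exact Hom.eqOn_closure this hx

theorem perm_ext {ι : Type*} (F : Finset ι) (e : ι → ι) (he : Set.InjOn e F) :
    ∃ π : Equiv.Perm ι, ∀ x ∈ F, π x = e x := by
  have := Equiv.Perm.isMultiplyPretransitive ι F.card
  have h := MulAction.isMultiplyPretransitive_iff.1 this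
  let k := F.equivFin
  obtain ⟨g, hg⟩ := h ⟨fun i => (k.symm i : ι), fun i j hij => k.symm.injective (Subtype.ext hij)⟩
    ⟨fun i => e (k.symm i : ι), fun i j hij =>
      k.symm.injective (Subtype.ext (he (k.symm i).2 (k.symm j).2 hij))⟩
  refine ⟨g, fun x hx => ?_⟩
  have h2 := congrArg (fun z : Fin F.card ↪ ι => z (k ⟨x, hx⟩)) hg
  have h3 : g ((k.symm (k ⟨x, hx⟩) : F) : ι) = e ((k.symm (k ⟨x, hx⟩) : F) : ι) := h2
  simpa using h3

theorem perm_into {ι : Type*} (F G : Finset ι) (B : Set ι) (hB : B.Infinite) :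
    ∃ π : Equiv.Perm ι, (∀ x ∈ G, π x = x) ∧ ∀ x ∈ F, x ∉ G → π x ∈ B \ G := by
  classical
  have hBG : (B \ (G : Set ι)).Infinite := hB.sdiff G.finite_toSet
  have := hBG.to_subtype
  let u : ℕ ↪ ↥(B \ (G : Set ι)) := Infinite.natEmbedding _
  let k := (F ∪ G).equivFin
  let e : ι → ι := fun x => if x ∈ G then x else
    if h : x ∈ F ∪ G then u (k ⟨x, h⟩) else x
  have hin : Set.InjOn e ((F ∪ G : Finset ι) : Set ι) := by
    intro x hx y hy hxy
    have hx' : x ∈ F ∪ G := hx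
    have hy' : y ∈ F ∪ G := hy
    by_cases h1 : x ∈ G <;> by_cases h2 : y ∈ G
    · simpa [e, h1, h2] using hxy
    · exfalso
      simp only [e, h1, h2, hy', if_true, if_false, dif_pos] at hxy
      exact (u (k ⟨y, hy'⟩)).2.2 (hxy ▸ h1)
    · exfalso
      simp only [e, h1, h2, hx', if_true, if_false, dif_pos] at hxy
      exact (u (k ⟨x, hx'⟩)).2.2 (hxy ▸ h2)
    · simp only [e, h1, h2, hx', hy', if_false, dif_pos] at hxy
      have h3 := k.injective (Fin.ext (u.injective (Subtype.ext hxy)))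
      exact congrArg Subtype.val h3
  obtain ⟨π, hπ⟩ := perm_ext (F ∪ G) e hin
  refine ⟨π, fun x hx => ?_, fun x hx hxG => ?_⟩
  · rw [hπ x (Finset.mem_union_right _ hx)]
    simp [e, hx]
  · have hx' : x ∈ F ∪ G := Finset.mem_union_left _ hx
    rw [hπ x hx']
    simp only [e, hxG, hx', if_false, dif_pos]
    exact (u _).2

theorem realize_aut₂ {n : ℕ} (E : L.Formula (Fin n ⊕ Fin n)) (σ : M ≃[L] M) (x y : Fin n → M) :
    E.Realize (Sum.elim (σ ∘ x) (σ ∘ y)) ↔ E.Realize (Sum.elim x y) := by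
  rw [← Sum.comp_elim]
  exact StrongHomClass.realize_formula σ E

theorem perm_class {T : L.Theory} {I : Set M} (hinf : I.Infinite) (hfree : IsFreeOn T M I)
    (n : ℕ) (E : L.Formula (Fin n ⊕ Fin n))
    (hsymm : ∀ x y : Fin n → M, E.Realize (Sum.elim x y) → E.Realize (Sum.elim y x))
    (htrans : ∀ x y z : Fin n → M,
      E.Realize (Sum.elim x y) → E.Realize (Sum.elim y z) → E.Realize (Sum.elim x z))
    (a : Fin n → M) (D : L.Formula (Fin n)) (hDa : D.Realize a)
    (S : Finset (Fin n → M))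
    (hS : ∀ x : Fin n → M, D.Realize x → ∃ s ∈ S, E.Realize (Sum.elim x s))
    (F : Finset I) (hF : ∀ l, a l ∈ closure L (Subtype.val '' (F : Set I)))
    (π : Equiv.Perm I) (σ : M ≃[L] M) (hσ : ∀ x : I, σ x = π x) :
    E.Realize (Sum.elim a (σ ∘ a)) := by
  classical
  have := hinf.to_subtype
  choose Φ hΦ using fun π : Equiv.Perm I => exists_aut_perm hfree π
  have agree : ∀ σ τ : M ≃[L] M, (∀ x ∈ F, σ (x : M) = τ x) → σ ∘ a = τ ∘ a := by
    intro σ τ h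
    funext l
    refine aut_eq_on σ τ _ ?_ _ (hF l)
    rintro _ ⟨x, hx, rfl⟩
    exact h x hx
  obtain ⟨c, hc⟩ := Set.countable_iff_exists_injOn.1 F.finite_toSet.countable
  let u : ℕ ↪ I := Infinite.natEmbedding _
  have hp : ∀ m : ℕ, ∃ π : Equiv.Perm I, ∀ x ∈ F, π x = u (Nat.pair m (c x)) := by
    intro m
    apply perm_ext
    intro x hx y hy hxy
    exact hc hx hy (Nat.pair_eq_pair.1 (u.injective hxy)).2
  choose p hp using hp
  have hs : ∀ m, ∃ s : S, E.Realize (Sum.elim (Φ (p m) ∘ a) s.1) := by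
    intro m
    obtain ⟨s, hs, h⟩ := hS (Φ (p m) ∘ a) ((StrongHomClass.realize_formula (Φ (p m)) D).2 hDa)
    exact ⟨⟨s, hs⟩, h⟩
  choose s hs using hs
  obtain ⟨m, m', hne, hmm⟩ := Finite.exists_ne_map_eq_of_infinite s
  have h1 : E.Realize (Sum.elim (Φ (p m) ∘ a) (Φ (p m') ∘ a)) :=
    htrans _ _ _ (hs m) (hsymm _ _ (hmm ▸ hs m'))
  have h2 : ∀ (τ₁ τ₂ : M ≃[L] M) (q₁ q₂ : Equiv.Perm I), (∀ x : I, τ₁ x = q₁ x) →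
      (∀ x : I, τ₂ x = q₂ x) → (∀ x ∈ F, ∀ y ∈ F, q₁ x ≠ q₂ y) →
      E.Realize (Sum.elim (τ₁ ∘ a) (τ₂ ∘ a)) := by
    intro τ₁ τ₂ q₁ q₂ hq₁ hq₂ hd
    let P := p m
    let P' := p m'
    have hPd : ∀ x ∈ F, ∀ y ∈ F, P x ≠ P' y := by
      intro x hx y hy h
      rw [hp m x hx, hp m' y hy] at h
      exact hne (Nat.pair_eq_pair.1 (u.injective h)).1
    let e : I → I := fun z => if P.symm z ∈ F then q₁ (P.symm z) else q₂ (P'.symm z)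
    have hP'e : ∀ y ∈ F, P.symm (P' y) ∉ F := by
      intro y hy h
      exact hPd _ h y hy (by simp)
    have he1 : ∀ x ∈ F, e (P x) = q₁ x := by
      intro x hx
      simp [e, hx]
    have he2 : ∀ x ∈ F, e (P' x) = q₂ x := by
      intro x hx
      simp [e, hP'e x hx]
    obtain ⟨κ, hκ⟩ := perm_ext (F.image P ∪ F.image P') e (by
      intro z hz w hw hzw
      simp only [Finset.coe_union, Finset.coe_image, mem_union, mem_image, Finset.mem_coe] at hz hw
      rcases hz with ⟨x, hx, rfl⟩ | ⟨x, hx, rfl⟩ <;> rcases hw with ⟨y, hy, rfl⟩ | ⟨y, hy, rfl⟩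
      · rw [he1 x hx, he1 y hy] at hzw
        rw [q₁.injective hzw]
      · rw [he1 x hx, he2 y hy] at hzw
        exact absurd hzw (hd x hx y hy)
      · rw [he2 x hx, he1 y hy] at hzw
        exact absurd hzw.symm (hd y hy x hx)
      · rw [he2 x hx, he2 y hy] at hzw
        rw [q₂.injective hzw])
    have h3 := (realize_aut₂ E (Φ κ) _ _).2 h1
    have e1 : Φ κ ∘ Φ (p m) ∘ a = τ₁ ∘ a := by
      refine agree ((Φ κ).comp (Φ (p m))) τ₁ fun x hx => ?_
      rw [Equiv.comp_apply, hΦ, hΦ, hq₁, hκ _ (by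
        exact Finset.mem_union_left _ (Finset.mem_image_of_mem _ hx)), he1 x hx]
    have e2 : Φ κ ∘ Φ (p m') ∘ a = τ₂ ∘ a := by
      refine agree ((Φ κ).comp (Φ (p m'))) τ₂ fun x hx => ?_
      rw [Equiv.comp_apply, hΦ, hΦ, hq₂, hκ _ (by
        exact Finset.mem_union_right _ (Finset.mem_image_of_mem _ hx)), he2 x hx]
    rwa [e1, e2] at h3
  have hB : ((F ∪ F.image π : Finset I) : Set I)ᶜ.Infinite := (Finset.finite_toSet _).infinite_compl
  obtain ⟨q, -, hq⟩ := perm_into F ∅ _ hB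
  have hq' : ∀ x ∈ F, q x ∉ F ∧ q x ∉ F.image π := by
    intro x hx
    have := (hq x hx (Finset.notMem_empty x)).1
    simpa only [mem_compl_iff, Finset.mem_coe, Finset.mem_union, not_or] using this
  have h4 := h2 (FirstOrder.Language.Equiv.refl L M) (Φ q) 1 q (fun x => rfl) (hΦ q)
    (fun x hx y hy h => (hq' y hy).1 (h ▸ hx))
  have h5 := h2 σ (Φ q) π q hσ (hΦ q)
    (fun x hx y hy h => (hq' y hy).2 (h ▸ Finset.mem_image_of_mem _ hx))
  exact htrans _ _ _ h4 (hsymm _ _ h5)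

theorem sat_finite (hsat : IsSat (L := L) M ℵ₁) {α : Type*} [Finite α] (d : α → M)
    (p : Set (L.Formula (α ⊕ Fin 1))) (hne : p.Nonempty)
    (hdir : ∀ φ ∈ p, ∀ ψ ∈ p, ∃ χ ∈ p, ∀ v : α ⊕ Fin 1 → M,
      χ.Realize v → φ.Realize v ∧ ψ.Realize v)
    (hfs : ∀ φ ∈ p, ∃ z : M, φ.Realize (Sum.elim d (fun _ => z))) :
    ∃ z : M, ∀ φ ∈ p, φ.Realize (Sum.elim d (fun _ => z)) := by
  classical
  let r : α ⊕ Fin 1 → ↥(Set.range d) ⊕ Fin 1 := Sum.map (fun x => ⟨d x, x, rfl⟩) id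
  have hr : ∀ (φ : L.Formula (α ⊕ Fin 1)) (a : Fin 1 → M),
      (φ.relabel r).Realize (Sum.elim (fun x : Set.range d => (x : M)) a) ↔
        φ.Realize (Sum.elim d (fun _ => a 0)) := by
    intro φ a
    rw [Formula.realize_relabel]
    have : (Sum.elim (fun x : Set.range d => (x : M)) a) ∘ r = Sum.elim d (fun _ => a 0) := by
      funext z
      rcases z with z | z
      · rfl
      · simp [r, Subsingleton.elim z 0]
    rw [this]
  obtain ⟨a, ha⟩ := hsat (Set.range d) (((Set.finite_range d).lt_aleph0).trans aleph0_lt_aleph_one)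
    ((fun φ => φ.relabel r) '' p) (by
      intro S hS
      have : ∃ χ ∈ p, ∀ ψ ∈ S, ∀ a : Fin 1 → M, χ.Realize (Sum.elim d (fun _ => a 0)) →
          ψ.Realize (Sum.elim (fun x : Set.range d => (x : M)) a) := by
        induction S using Finset.induction_on with
        | empty => exact ⟨hne.some, hne.some_mem, by simp⟩
        | insert ψ S hψ ih =>
          rw [Finset.coe_insert, Set.insert_subset_iff] at hS
          obtain ⟨χ, hχ, h⟩ := ih hS.2
          obtain ⟨φ, hφ, rfl⟩ := hS.1
          obtain ⟨χ', hχ', h'⟩ := hdir χ hχ φ hφ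
          refine ⟨χ', hχ', fun ψ hψ a ha => ?_⟩
          rcases Finset.mem_insert.1 hψ with rfl | hψ
          · exact (hr φ a).2 (h' _ ha).2
          · exact h ψ hψ a (h' _ ha).1
      obtain ⟨χ, hχ, h⟩ := this
      obtain ⟨z, hz⟩ := hfs χ hχ
      exact ⟨fun _ => z, fun ψ hψ => h ψ hψ _ hz⟩)
  exact ⟨a 0, fun φ hφ => (hr φ a).1 (ha _ ⟨φ, hφ, rfl⟩)⟩

/-- A set of pairs is (the graph of) a partial elementary map. -/
def El (L : FirstOrder.Language.{u, v}) {M : Type w} [L.Structure M] (s : Set (M × M)) : Prop :=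
  ∀ φ : L.Formula s, φ.Realize (fun p => p.1.1) ↔ φ.Realize (fun p => p.1.2)

theorem El.app {s : Set (M × M)} (h : El L s) {β : Type*} (p : β → M × M) (hp : ∀ b, p b ∈ s)
    (φ : L.Formula β) :
    φ.Realize (fun b => (p b).1) ↔ φ.Realize (fun b => (p b).2) := by
  have := h (φ.relabel (fun b => ⟨p b, hp b⟩))
  rw [Formula.realize_relabel, Formula.realize_relabel] at this
  exact this

theorem El.swap {s : Set (M × M)} (h : El L s) : El L (Prod.swap ⁻¹' s) :=
  fun φ => (h.app (fun p : ↥(Prod.swap ⁻¹' s) => p.1.swap) (fun p => p.2) φ).symm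

theorem El.insert_of {s : Set (M × M)} (x y : M)
    (h : ∀ φ : L.Formula (s ⊕ Fin 1), φ.Realize (Sum.elim (fun p => p.1.1) (fun _ => x)) →
      φ.Realize (Sum.elim (fun p => p.1.2) (fun _ => y))) : El L (insert (x, y) s) := by
  classical
  have h' : ∀ φ : L.Formula (s ⊕ Fin 1), φ.Realize (Sum.elim (fun p => p.1.1) (fun _ => x)) ↔
      φ.Realize (Sum.elim (fun p => p.1.2) (fun _ => y)) := by
    intro φ
    refine ⟨h φ, fun h2 => ?_⟩
    by_contra h3
    exact (Formula.realize_not.1 (h φ.not (Formula.realize_not.2 h3))) h2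
  intro φ
  let r : ↥(insert (x, y) s) → s ⊕ Fin 1 := fun q =>
    if hq : q.1 ∈ s then Sum.inl ⟨q.1, hq⟩ else Sum.inr 0
  have := h' (φ.relabel r)
  rw [Formula.realize_relabel, Formula.realize_relabel] at this
  convert this using 2
  · funext q
    by_cases hq : q.1 ∈ s
    · simp [r, hq]
    · have : q.1 = (x, y) := q.2.resolve_right hq
      simp only [r, hq, Function.comp, dif_neg, not_false_iff, Sum.elim_inr]
      rw [this]
  · funext q
    by_cases hq : q.1 ∈ s
    · simp [r, hq]
    · have : q.1 = (x, y) := q.2.resolve_right hq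
      simp only [r, hq, Function.comp, dif_neg, not_false_iff, Sum.elim_inr]
      rw [this]

theorem El.extend {T : L.Theory} (hT : IsEquational T) {I : Set M} (hfree : IsFreeOn T M I)
    (hsat : IsSat (L := L) M ℵ₁) (J : Set I) (hJ : J.Infinite) {s : Set (M × M)} (h : El L s)
    (hs : s.Finite) (hsJ : ∀ p ∈ s, p.2 ∈ closure L (Subtype.val '' J)) (x : M) :
    ∃ y ∈ closure L (Subtype.val '' J), El L (insert (x, y) s) := by
  classical
  have := hs.to_subtype
  obtain ⟨y, hy⟩ := sat_finite hsat (fun p : s => p.1.2)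
    {φ : L.Formula (s ⊕ Fin 1) | φ.Realize (Sum.elim (fun p => p.1.1) (fun _ => x))}
    ⟨⊤, by simp⟩ (by
      intro φ hφ ψ hψ
      refine ⟨φ ⊓ ψ, Formula.realize_inf.2 ⟨hφ, hψ⟩, fun v hv => Formula.realize_inf.1 hv⟩) (by
      intro φ hφ
      have := (h (φ.iExs (Fin 1))).1 (Formula.realize_iExs.2 ⟨_, hφ⟩)
      obtain ⟨i, hi⟩ := Formula.realize_iExs.1 this
      refine ⟨i 0, ?_⟩
      have e : i = fun _ => i 0 := funext fun k => by rw [Subsingleton.elim k 0]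
      rwa [← e])
  obtain ⟨F, hF⟩ := exists_supp hT hfree y
  have hG : ∃ G : Finset I, (G : Set I) ⊆ J ∧
      ∀ p : s, p.1.2 ∈ closure L (Subtype.val '' (G : Set I)) := by
    have h1 : ∀ p : s, ∃ G : Finset I, (G : Set I) ⊆ J ∧
        p.1.2 ∈ closure L (Subtype.val '' (G : Set I)) := by
      intro p
      obtain ⟨t, ht⟩ := mem_closure_iff_exists_term.1 (hsJ p.1 p.2)
      have hm : ∀ v : ↥(Subtype.val '' J), (v : M) ∈ I := by
        rintro ⟨_, w, hw, rfl⟩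
        exact w.2
      refine ⟨t.varFinset.image (fun v => ⟨v.1, hm v⟩), ?_, mem_closure_iff_exists_term.2
        ⟨t.restrictVar (fun v => ⟨v.1.1, ⟨v.1.1, hm v.1⟩,
          Finset.mem_coe.2 (Finset.mem_image_of_mem _ v.2), rfl⟩), ?_⟩⟩
      · intro z hz
        obtain ⟨⟨_, w, hw, rfl⟩, hv, rfl⟩ := Finset.mem_image.1 (Finset.mem_coe.1 hz)
        exact hw
      · rw [← ht]
        exact Term.realize_restrictVar _ (fun _ => rfl)
    choose G hG1 hG2 using h1
    have := Fintype.ofFinite s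
    refine ⟨Finset.univ.biUnion G, ?_, fun p => closure_mono (image_mono ?_) (hG2 p)⟩
    · intro z hz
      obtain ⟨p, -, hp⟩ := Finset.mem_biUnion.1 (Finset.mem_coe.1 hz)
      exact hG1 p hp
    · intro z hz
      exact Finset.mem_coe.2 (Finset.mem_biUnion.2 ⟨p, Finset.mem_univ _, hz⟩)
  obtain ⟨G, hGJ, hG⟩ := hG
  obtain ⟨π, hπG, hπF⟩ := perm_into F G J hJ
  obtain ⟨τ, hτ⟩ := exists_aut_perm hfree π
  refine ⟨τ y, ?_, El.insert_of _ _ fun φ hφ => ?_⟩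
  · have hle : closure L (Subtype.val '' (F : Set I)) ≤
        (closure L (Subtype.val '' J)).comap τ.toHom := by
      rw [closure_le]
      rintro _ ⟨z, hz, rfl⟩
      change τ z ∈ closure L (Subtype.val '' J)
      rw [hτ]
      apply Substructure.subset_closure
      refine ⟨π z, ?_, rfl⟩
      by_cases hzG : z ∈ G
      · rw [hπG z hzG]
        exact hGJ hzG
      · exact (hπF z hz hzG).1
    exact hle hF
  · have h1 := (StrongHomClass.realize_formula τ φ).2 (hy φ hφ)
    convert h1 using 1
    rw [Sum.comp_elim]
    congr 1
    funext p
    refine aut_eq_on (FirstOrder.Language.Equiv.refl L M) τ _ ?_ _ (hG p)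
    rintro _ ⟨z, hz, rfl⟩
    rw [hτ, hπG z hz]
    rfl

theorem graph_hom {C : Set M} (U : Set (M × M))
    (hU : ∀ W : Set (M × M), W.Finite → W ⊆ U → El L W)
    (f : M →[L] M) (hf : ∀ j ∈ C, (j, f j) ∈ U) (x y : M) (hxy : (x, y) ∈ U)
    (hx : x ∈ closure L C) : f x = y := by
  classical
  obtain ⟨t, ht⟩ := mem_closure_iff_exists_term.1 hx
  let p : t.varFinset ⊕ Fin 1 → M × M :=
    Sum.elim (fun v => ((v.1 : M), f v.1)) (fun _ => (x, y))
  have hW := hU (Set.range p) (Set.finite_range p) (by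
    rintro _ ⟨z | z, rfl⟩
    · exact hf _ z.1.2
    · exact hxy)
  have h := hW.app p (fun b => ⟨b, rfl⟩)
    (Term.equal (t.restrictVar Sum.inl) (Term.var (Sum.inr 0)))
  rw [Formula.realize_equal, Formula.realize_equal] at h
  have e1 : (t.restrictVar (Sum.inl : t.varFinset → t.varFinset ⊕ Fin 1)).realize
      (fun b => (p b).1) = t.realize (fun v : C => (v : M)) :=
    Term.realize_restrictVar _ (fun _ => rfl)
  have e2 : (t.restrictVar (Sum.inl : t.varFinset → t.varFinset ⊕ Fin 1)).realize
      (fun b => (p b).2) = t.realize (fun v : C => f (v : M)) :=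
    Term.realize_restrictVar _ (fun _ => rfl)
  rw [e1, e2] at h
  have h2 := h.1 ht
  have h3 := HomClass.realize_term f (t := t) (v := fun v : C => (v : M))
  rw [← ht, ← h3]
  exact h2

theorem exists_aut_of_type {T : L.Theory} (hT : IsEquational T) {I : Set M}
    (hfree : IsFreeOn T M I) (hsat : IsSat (L := L) M ℵ₁) (J : Set I) (hJ : J.Infinite)
    (hJc : J.Countable) {n : ℕ} (a b : Fin n → M)
    (ha : ∀ l, a l ∈ closure L (Subtype.val '' J)) (hb : ∀ l, b l ∈ closure L (Subtype.val '' J))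
    (hab : SameType₀ (L := L) a b) :
    ∃ σ : M ≃[L] M, σ ∘ a = b ∧ ∀ x : I, x ∉ J → σ x = x := by
  classical
  let C := closure L (Subtype.val '' J : Set M)
  let P := {s : Finset (M × M) // El L (s : Set (M × M)) ∧ ∀ p ∈ s, p.1 ∈ C ∧ p.2 ∈ C}
  have hext1 : ∀ (s : P) (x : M), x ∈ C → ∃ s' : P, s ≤ s' ∧ ∃ y, (x, y) ∈ s'.1 := by
    intro s x hx
    obtain ⟨y, hy, h⟩ := El.extend hT hfree hsat J hJ s.2.1 s.1.finite_toSet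
      (fun p hp => (s.2.2 p hp).2) x
    refine ⟨⟨insert (x, y) s.1, by rwa [Finset.coe_insert], ?_⟩,
      Finset.subset_insert _ _, y, Finset.mem_insert_self _ _⟩
    intro p hp
    rcases Finset.mem_insert.1 hp with rfl | hp
    · exact ⟨hx, hy⟩
    · exact s.2.2 p hp
  have hext2 : ∀ (s : P) (y : M), y ∈ C → ∃ s' : P, s ≤ s' ∧ ∃ x, (x, y) ∈ s'.1 := by
    intro s y hy
    obtain ⟨x, hx, h⟩ := El.extend hT hfree hsat J hJ s.2.1.swap
      (s.1.finite_toSet.preimage Prod.swap_injective.injOn)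
      (fun p hp => (s.2.2 p.swap hp).1) y
    refine ⟨⟨insert (x, y) s.1, ?_, ?_⟩,
      Finset.subset_insert _ _, x, Finset.mem_insert_self _ _⟩
    · have h2 := h.swap
      convert h2 using 1
      ext ⟨p, q⟩
      simp [and_comm]
    · intro p hp
      rcases Finset.mem_insert.1 hp with rfl | hp
      · exact ⟨hx, hy⟩
      · exact s.2.2 p hp
  have hJC : ∀ j : I, j ∈ J → (j : M) ∈ C := fun j hj =>
    Substructure.subset_closure ⟨j, hj, rfl⟩
  let 𝒟 : J ⊕ J → Order.Cofinal P := Sum.elim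
    (fun j => ⟨{s | ∃ y, (((j : I) : M), y) ∈ s.1}, fun s => by
      obtain ⟨s', h1, h2⟩ := hext1 s j (hJC _ j.2)
      exact ⟨s', h2, h1⟩⟩)
    (fun j => ⟨{s | ∃ x, (x, ((j : I) : M)) ∈ s.1}, fun s => by
      obtain ⟨s', h1, h2⟩ := hext2 s j (hJC _ j.2)
      exact ⟨s', h2, h1⟩⟩)
  let p₀ : P := ⟨Finset.univ.image (fun l => (a l, b l)), by
    intro φ
    have hr : ∀ q : ↥((Finset.univ.image (fun l => (a l, b l)) : Finset (M × M)) : Set (M × M)),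
        ∃ l, (a l, b l) = q.1 := by
      intro q
      obtain ⟨l, -, h⟩ := Finset.mem_image.1 (Finset.mem_coe.1 q.2)
      exact ⟨l, h⟩
    choose r hr using hr
    have h := hab (φ.relabel r)
    rw [Formula.realize_relabel, Formula.realize_relabel] at h
    convert h using 2
    · funext q
      simp [← hr q]
    · funext q
      simp [← hr q], by
    intro p hp
    obtain ⟨l, -, rfl⟩ := Finset.mem_image.1 hp
    exact ⟨ha l, hb l⟩⟩
  have := hJc.to_subtype
  letI : Encodable (J ⊕ J) := Encodable.ofCountable _
  let seq := Order.sequenceOfCofinals p₀ 𝒟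
  have hmono : Monotone seq := Order.sequenceOfCofinals.monotone p₀ 𝒟
  let U : Set (M × M) := {p | ∃ m, p ∈ (seq m).1}
  have hUC : ∀ p ∈ U, p.1 ∈ C ∧ p.2 ∈ C := fun p ⟨m, hm⟩ => (seq m).2.2 p hm
  have hU : ∀ W : Set (M × M), W.Finite → W ⊆ U → El L W := by
    intro W hW hWU
    have hm : ∃ m, W ⊆ (seq m).1 := by
      induction W, hW using Set.Finite.induction_on with
      | empty => exact ⟨0, by simp⟩
      | insert _ _ ih =>
        rw [Set.insert_subset_iff] at hWU
        obtain ⟨m, hm⟩ := ih hWU.2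
        obtain ⟨k, hk⟩ := hWU.1
        refine ⟨max m k, Set.insert_subset_iff.2 ⟨hmono (le_max_right m k) hk,
          fun z hz => hmono (le_max_left m k) (hm hz)⟩⟩
    obtain ⟨m, hm⟩ := hm
    intro φ
    exact (seq m).2.1.app (fun q : W => q.1) (fun q => hm q.2) φ
  have hU' : ∀ W : Set (M × M), W.Finite → W ⊆ Prod.swap ⁻¹' U → El L W := by
    intro W hW hWU
    have := (hU (Prod.swap ⁻¹' W) (hW.preimage Prod.swap_injective.injOn)
      (fun z hz => by simpa using hWU hz)).swap
    rw [← Set.preimage_comp] at this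
    simpa using this
  have hF : ∀ j : I, ∃ y : M, (j ∈ J → ((j : M), y) ∈ U) ∧ (j ∉ J → y = j) := by
    intro j
    by_cases hj : j ∈ J
    · obtain ⟨y, hy⟩ : ∃ y, ((j : M), y) ∈ _ :=
        Order.sequenceOfCofinals.encode_mem p₀ 𝒟 (Sum.inl ⟨j, hj⟩)
      exact ⟨y, fun _ => ⟨_, hy⟩, fun h => absurd hj h⟩
    · exact ⟨j, fun h => absurd h hj, fun _ => rfl⟩
  have hG : ∀ j : I, ∃ y : M, (j ∈ J → (y, (j : M)) ∈ U) ∧ (j ∉ J → y = j) := by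
    intro j
    by_cases hj : j ∈ J
    · obtain ⟨y, hy⟩ : ∃ y, (y, (j : M)) ∈ _ :=
        Order.sequenceOfCofinals.encode_mem p₀ 𝒟 (Sum.inr ⟨j, hj⟩)
      exact ⟨y, fun _ => ⟨_, hy⟩, fun h => absurd hj h⟩
    · exact ⟨j, fun h => absurd h hj, fun _ => rfl⟩
  choose f₀ hf₁ hf₂ using hF
  choose g₀ hg₁ hg₂ using hG
  obtain ⟨f, hf, -⟩ := hfree.2 M _ hfree.1 f₀
  obtain ⟨g, hg, -⟩ := hfree.2 M _ hfree.1 g₀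
  have hfU : ∀ x y, (x, y) ∈ U → f x = y := fun x y hxy =>
    graph_hom U hU f (by
      rintro _ ⟨j, hj, rfl⟩
      rw [hf]
      exact hf₁ j hj) x y hxy (hUC _ hxy).1
  have hgU : ∀ x y, (x, y) ∈ U → g y = x := fun x y hxy =>
    graph_hom (Prod.swap ⁻¹' U) hU' g (by
      rintro _ ⟨j, hj, rfl⟩
      rw [hg]
      exact hg₁ j hj) y x hxy (hUC _ hxy).2
  obtain ⟨σ, hσ⟩ := exists_aut_of_homs hfree f g
    (by
      intro x
      by_cases hx : x ∈ J
      · rw [hf]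
        exact hgU _ _ (hf₁ x hx)
      · rw [hf, hf₂ x hx, hg, hg₂ x hx])
    (by
      intro x
      by_cases hx : x ∈ J
      · rw [hg]
        exact hfU _ _ (hg₁ x hx)
      · rw [hg, hg₂ x hx, hf, hf₂ x hx])
  refine ⟨σ, ?_, fun x hx => by rw [hσ, hf, hf₂ x hx]⟩
  funext l
  rw [Function.comp_apply, hσ]
  exact hfU _ _ ⟨0, Finset.mem_image_of_mem _ (Finset.mem_univ l)⟩

theorem sat_tuple (hsat : IsSat (L := L) M ℵ₁) {n : ℕ} (E : L.Formula (Fin n ⊕ Fin n))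
    (a s : Fin n → M)
    (h : ∀ θ : L.Formula (Fin n), θ.Realize a → ∃ x, θ.Realize x ∧ E.Realize (Sum.elim x s)) :
    ∃ b : Fin n → M, SameType₀ (L := L) a b ∧ E.Realize (Sum.elim b s) := by
  classical
  have key : ∀ k : ℕ, ∃ b : Fin n → M, ∀ θ : L.Formula (Fin n), θ.Realize a →
      ∃ x : Fin n → M, (∀ l : Fin n, (l : ℕ) < k → x l = b l) ∧ θ.Realize x ∧
        E.Realize (Sum.elim x s) := by
    intro k
    induction k with
    | zero =>
      refine ⟨s, fun θ hθ => ?_⟩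
      obtain ⟨x, hx⟩ := h θ hθ
      exact ⟨x, fun l hl => absurd hl (Nat.not_lt_zero _), hx⟩
    | succ k ih =>
      obtain ⟨b, hb⟩ := ih
      by_cases hk : k < n
      swap
      · refine ⟨b, fun θ hθ => ?_⟩
        obtain ⟨x, hx, hx'⟩ := hb θ hθ
        exact ⟨x, fun l hl => hx l (by omega), hx'⟩
      let eqs : L.Formula (((Fin n ⊕ Fin n) ⊕ Fin 1) ⊕ Fin n) :=
        Formula.iInf (fun l : {l : Fin n // (l : ℕ) < k} =>
          Term.equal (Term.var (Sum.inr l.1)) (Term.var (Sum.inl (Sum.inl (Sum.inl l.1)))))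
      let eqk : L.Formula (((Fin n ⊕ Fin n) ⊕ Fin 1) ⊕ Fin n) :=
        Term.equal (Term.var (Sum.inr ⟨k, hk⟩)) (Term.var (Sum.inl (Sum.inr 0)))
      let Es : L.Formula (((Fin n ⊕ Fin n) ⊕ Fin 1) ⊕ Fin n) :=
        E.relabel (Sum.elim Sum.inr (fun l => Sum.inl (Sum.inl (Sum.inr l))))
      let Θ : L.Formula (Fin n) → L.Formula ((Fin n ⊕ Fin n) ⊕ Fin 1) := fun θ =>
        Formula.iExs (Fin n) (eqs ⊓ (eqk ⊓ (θ.relabel Sum.inr ⊓ Es)))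
      have hΘ : ∀ θ (v : (Fin n ⊕ Fin n) ⊕ Fin 1 → M), (Θ θ).Realize v ↔
          ∃ x : Fin n → M, (∀ l : Fin n, (l : ℕ) < k → x l = v (Sum.inl (Sum.inl l))) ∧
            x ⟨k, hk⟩ = v (Sum.inr 0) ∧ θ.Realize x ∧
            E.Realize (Sum.elim x (fun l => v (Sum.inl (Sum.inr l)))) := by
        intro θ v
        have e : ∀ x : Fin n → M, (Sum.elim v x ∘ Sum.elim Sum.inr
            (fun l : Fin n => Sum.inl (Sum.inl (Sum.inr l)))) =
            Sum.elim x (fun l => v (Sum.inl (Sum.inr l))) := by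
          intro x
          funext z
          rcases z with z | z <;> rfl
        simp only [Θ, Formula.realize_iExs, Formula.realize_inf, eqs, eqk, Es,
          Formula.realize_iInf, Formula.realize_equal, Term.realize_var, Sum.elim_inr,
          Sum.elim_inl, Formula.realize_relabel, Sum.elim_comp_inr, e, Subtype.forall]
      obtain ⟨z, hz⟩ := sat_finite hsat (Sum.elim b s) {χ | ∃ θ, θ.Realize a ∧ χ = Θ θ}
        ⟨Θ ⊤, ⊤, by simp, rfl⟩ (by
          rintro _ ⟨θ, hθ, rfl⟩ _ ⟨θ', hθ', rfl⟩
          refine ⟨_, ⟨θ ⊓ θ', Formula.realize_inf.2 ⟨hθ, hθ'⟩, rfl⟩, fun v hv => ?_⟩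
          obtain ⟨x, h1, h2, h3, h4⟩ := (hΘ _ v).1 hv
          rw [Formula.realize_inf] at h3
          exact ⟨(hΘ _ v).2 ⟨x, h1, h2, h3.1, h4⟩, (hΘ _ v).2 ⟨x, h1, h2, h3.2, h4⟩⟩) (by
          rintro _ ⟨θ, hθ, rfl⟩
          obtain ⟨x, h1, h2, h3⟩ := hb θ hθ
          exact ⟨x ⟨k, hk⟩, (hΘ _ _).2 ⟨x, h1, rfl, h2, h3⟩⟩)
      refine ⟨Function.update b ⟨k, hk⟩ z, fun θ hθ => ?_⟩
      obtain ⟨x, h1, h2, h3, h4⟩ := (hΘ _ _).1 (hz _ ⟨θ, hθ, rfl⟩)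
      refine ⟨x, fun l hl => ?_, h3, h4⟩
      by_cases hlk : l = ⟨k, hk⟩
      · subst hlk
        rw [Function.update_self]
        exact h2
      · rw [Function.update_of_ne hlk]
        refine h1 l ?_
        have : (l : ℕ) ≠ k := fun h => hlk (Fin.ext h)
        omega
  obtain ⟨b, hb⟩ := key n
  have hb' : ∀ θ : L.Formula (Fin n), θ.Realize a → θ.Realize b ∧ E.Realize (Sum.elim b s) := by
    intro θ hθ
    obtain ⟨x, h1, h2⟩ := hb θ hθ
    have : x = b := funext fun l => h1 l l.2
    rwa [← this]
  refine ⟨b, fun θ => ⟨fun hθ => (hb' θ hθ).1, fun hθ => ?_⟩, (hb' ⊤ (by simp)).2⟩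
  by_contra h3
  exact (Formula.realize_not.1 (hb' θ.not (Formula.realize_not.2 h3)).1) hθ

theorem main_aux {T : L.Theory} (hT : IsEquational T)
    (I : Set M) (hcard : #I = ℵ₁)
    (hfree : IsFreeOn T M I) (hsat : IsSat (L := L) M ℵ₁)
    (n : ℕ) (E : L.Formula (Fin n ⊕ Fin n))
    (hsymm : ∀ x y : Fin n → M, E.Realize (Sum.elim x y) → E.Realize (Sum.elim y x))
    (htrans : ∀ x y z : Fin n → M,
      E.Realize (Sum.elim x y) → E.Realize (Sum.elim y z) → E.Realize (Sum.elim x z))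
    (a : Fin n → M) (D : L.Formula (Fin n)) (hDa : D.Realize a)
    (S : Finset (Fin n → M))
    (hS : ∀ x : Fin n → M, D.Realize x → ∃ s ∈ S, E.Realize (Sum.elim x s))
    (b : Fin n → M) (hab : SameType₀ (L := L) a b) : E.Realize (Sum.elim a b) := by
  classical
  have hunc : Uncountable I := by
    rw [← aleph0_lt_mk_iff, hcard]
    exact aleph0_lt_aleph_one
  have hinf : I.Infinite := Set.infinite_coe_iff.1 inferInstance
  obtain ⟨F, hF⟩ := exists_supp_finite hT hfree a
  obtain ⟨G, hG⟩ := exists_supp_finite hT hfree b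
  let u : ℕ ↪ I := Infinite.natEmbedding _
  let J : Set I := Set.range u ∪ (F ∪ G)
  have hJi : J.Infinite := (Set.infinite_range_of_injective u.injective).mono subset_union_left
  have hJc : J.Countable := (Set.countable_range u).union
    (F.countable_toSet.union G.countable_toSet)
  obtain ⟨σ, hσ, hσJ⟩ := exists_aut_of_type hT hfree hsat J hJi hJc a b
    (fun l => closure_mono (image_mono (fun z hz => Or.inr (Or.inl hz))) (hF l))
    (fun l => closure_mono (image_mono (fun z hz => Or.inr (Or.inr hz))) (hG l)) hab
  have hJco : Jᶜ.Infinite := by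
    intro h
    apply Set.not_countable_univ (α := I)
    rw [← Set.union_compl_self J]
    exact hJc.union h.countable
  obtain ⟨π, -, hπ⟩ := perm_into F ∅ Jᶜ hJco
  obtain ⟨τ, hτ⟩ := exists_aut_perm hfree π
  have h1 := perm_class hinf hfree n E hsymm htrans a D hDa S hS F hF π τ hτ
  have h2 := (realize_aut₂ E σ _ _).2 h1
  have h3 : σ ∘ τ ∘ a = τ ∘ a := by
    funext l
    refine aut_eq_on (σ.comp τ) τ _ ?_ _ (hF l)
    rintro _ ⟨x, hx, rfl⟩
    rw [Equiv.comp_apply, hτ]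
    exact hσJ _ (hπ x hx (Finset.notMem_empty x)).1
  rw [h3, hσ] at h2
  exact htrans _ _ _ h1 (hsymm _ _ h2)

end Helpers

end Paper

open Paper in
/-- for the theory of a saturated free algebra, `acl^eq(∅) = dcl^eq(∅)`: whenever
the class of a tuple `a` under a `∅`-definable equivalence relation `E` lies in a `∅`-definable
finite union of `E`-classes, the class of `a` is itself `∅`-definable. -/
theorem stmt_11 {L : FirstOrder.Language.{u, v}} (hfun : ∀ n, IsEmpty (L.Relations n))
    (T : L.Theory) (hT : IsEquational T)
    (M : Type w) [L.Structure M] (I : Set M) (hcard : #I = ℵ₁)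
    (hfree : IsFreeOn T M I) (hsat : IsSat (L := L) M ℵ₁)
    (n : ℕ) (E : L.Formula (Fin n ⊕ Fin n))
    (hrefl : ∀ x : Fin n → M, E.Realize (Sum.elim x x))
    (hsymm : ∀ x y : Fin n → M, E.Realize (Sum.elim x y) → E.Realize (Sum.elim y x))
    (htrans : ∀ x y z : Fin n → M,
      E.Realize (Sum.elim x y) → E.Realize (Sum.elim y z) → E.Realize (Sum.elim x z))
    (a : Fin n → M)
    (halg : ∃ D : L.Formula (Fin n), D.Realize a ∧
      (∀ x y : Fin n → M, D.Realize x → E.Realize (Sum.elim x y) → D.Realize y) ∧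
      ∃ S : Finset (Fin n → M), ∀ x : Fin n → M, D.Realize x →
        ∃ s ∈ S, E.Realize (Sum.elim x s)) :
    ∃ ψ : L.Formula (Fin n), ∀ x : Fin n → M, ψ.Realize x ↔ E.Realize (Sum.elim x a) := by
  classical
  obtain ⟨D, hDa, -, S, hS⟩ := halg
  have hθ : ∀ s : S, ∃ θ : L.Formula (Fin n), θ.Realize a ∧
      ∀ x, θ.Realize x → E.Realize (Sum.elim x s.1) → E.Realize (Sum.elim a s.1) := by
    intro s
    by_contra hcon
    push Not at hcon
    obtain ⟨b, hb, hbs⟩ := sat_tuple hsat E a s.1 (fun θ hθ => by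
      obtain ⟨x, h1, h2, -⟩ := hcon θ hθ
      exact ⟨x, h1, h2⟩)
    obtain ⟨x, -, -, h3⟩ := hcon ⊤ (by simp)
    exact h3 (htrans _ _ _ (main_aux hT I hcard hfree hsat n E hsymm htrans a D hDa S hS b hb) hbs)
  choose θ hθa hθ using hθ
  let Ω : L.Formula (Fin n) := D ⊓ Formula.iInf θ
  refine ⟨Formula.iExs (Fin n) (Ω.relabel Sum.inr ⊓ E), fun x => ?_⟩
  simp only [Formula.realize_iExs, Formula.realize_inf, Formula.realize_relabel,
    Sum.elim_comp_inr, Ω, Formula.realize_iInf]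
  constructor
  · rintro ⟨y, ⟨hDy, hy⟩, hxy⟩
    obtain ⟨s, hs, hys⟩ := hS y hDy
    have := hθ ⟨s, hs⟩ y (hy ⟨s, hs⟩) hys
    exact htrans _ _ _ hxy (htrans _ _ _ hys (hsymm _ _ this))
  · intro hx
    exact ⟨a, ⟨hDa, hθa⟩, hx⟩
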